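/- Let n ≥ 1, let Ω ⊆ ℝⁿ be a nonempty bounded open set, and let κ̄ > 0. Let u : [0,∞) × ℝⁿ → ℝ be continuous on [0,∞) × cl(Ω), such that on (0,∞) × Ω the function u is differentiable in t and twice differentiable in x and satisfies the heat equation ∂ₜu(t,x) = κ̄·Δu(t,x), and such that u(t,x) = 0 for all t ≥ 0 and all x in the boundary ∂Ω. Then max_{x ∈ cl(Ω)} |u(t,x)| → 0 as t → ∞. -/

import Mathlib

open Real Filter
open scoped Topology

/-- The Laplacian of `f : ℝⁿ → ℝ` at `x`: the sum of the unmixed second partial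
derivatives (the trace of the second derivative). -/
noncomputable def laplacian {n : ℕ} (f : EuclideanSpace ℝ (Fin n) → ℝ)
    (x : EuclideanSpace ℝ (Fin n)) : ℝ :=
  ∑ i, fderiv ℝ (fun y => fderiv ℝ f y (EuclideanSpace.single i 1)) x
    (EuclideanSpace.single i 1)

/-- The second derivative in any direction is nonpositive at a local maximum. -/
theorem IsLocalMax.fderiv_fderiv_apply_nonpos {E : Type*} [NormedAddCommGroup E]
    [NormedSpace ℝ E] {f : E → ℝ} {x : E} (hmax : IsLocalMax f x)
    (hd : ∀ᶠ y in 𝓝 x, DifferentiableAt ℝ f y) (hd2 : DifferentiableAt ℝ (fderiv ℝ f) x) (v : E) :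
    fderiv ℝ (fun y => fderiv ℝ f y v) x v ≤ 0 := by
  by_contra! hpos
  have hline : ∀ s : ℝ, HasDerivAt (fun s : ℝ => x + s • v) v s := fun s => by
    simpa using ((hasDerivAt_id s).smul_const v).const_add x
  have htend : Tendsto (fun s : ℝ => x + s • v) (𝓝 0) (𝓝 x) := by
    simpa [ContinuousAt] using (hline 0).continuousAt
  set h : ℝ → ℝ := fun s => f (x + s • v) with hh
  have hderiv : deriv h =ᶠ[𝓝 0] fun s => fderiv ℝ f (x + s • v) v := by
    filter_upwards [htend.eventually hd] with s hs
    exact (hs.hasFDerivAt.comp_hasDerivAt s (hline s)).deriv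
  have hderiv2 : deriv (deriv h) 0 = fderiv ℝ (fun y => fderiv ℝ f y v) x v := by
    rw [hderiv.deriv_eq]
    have h1 : DifferentiableAt ℝ (fun y => fderiv ℝ f y v) x :=
      hd2.clm_apply (differentiableAt_const v)
    have h2 : HasFDerivAt (fun y => fderiv ℝ f y v) (fderiv ℝ (fun y => fderiv ℝ f y v) x)
        (x + (0 : ℝ) • v) := by simpa using h1.hasFDerivAt
    exact (h2.comp_hasDerivAt (0 : ℝ) (hline 0)).deriv
  have hlmax : IsLocalMax h 0 := by
    filter_upwards [htend.eventually hmax] with s hs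
    simpa [hh] using hs
  have hcont : ContinuousAt h 0 := by
    refine ContinuousAt.comp (f := fun s : ℝ => x + s • v) (g := f) ?_ (hline 0).continuousAt
    simpa using hd.self_of_nhds.continuousAt
  have hlmin : IsLocalMin h 0 :=
    isLocalMin_of_deriv_deriv_pos (hderiv2 ▸ hpos) hlmax.deriv_eq_zero hcont
  have hconst : h =ᶠ[𝓝 0] fun _ => h 0 := by
    filter_upwards [hlmax, hlmin] with s h1 h2 using le_antisymm h1 h2
  have hzero : deriv (deriv h) 0 = 0 := by
    rw [hconst.deriv.deriv_eq]
    simp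
  exact absurd (hderiv2 ▸ hzero) hpos.ne'

/-- The derivative is nonnegative at a point where the maximum over a left interval is attained. -/
theorem HasDerivAt.nonneg_of_isMaxOn_Icc {f : ℝ → ℝ} {f' a b : ℝ} (hf : HasDerivAt f f' b)
    (hab : a < b) (hmax : IsMaxOn f (Set.Icc a b) b) : 0 ≤ f' := by
  have hcone : a - b ∈ posTangentConeAt (Set.Icc a b) b :=
    sub_mem_posTangentConeAt_of_segment_subset (by rw [segment_symm, segment_eq_Icc hab.le])
  have h := hmax.localize.hasFDerivWithinAt_nonpos hf.hasFDerivAt.hasFDerivWithinAt hcone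
  simp at h
  nlinarith

section Laplacian

variable {n : ℕ} {f g : EuclideanSpace ℝ (Fin n) → ℝ} {x : EuclideanSpace ℝ (Fin n)}

theorem laplacian_neg (f : EuclideanSpace ℝ (Fin n) → ℝ) (x : EuclideanSpace ℝ (Fin n)) :
    laplacian (fun y => -f y) x = -laplacian f x := by
  simp [laplacian, fderiv_fun_neg]

theorem IsLocalMax.laplacian_nonpos (hmax : IsLocalMax f x)
    (hd : ∀ᶠ y in 𝓝 x, DifferentiableAt ℝ f y) (hd2 : DifferentiableAt ℝ (fderiv ℝ f) x) :
    laplacian f x ≤ 0 :=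
  Finset.sum_nonpos fun _ _ => hmax.fderiv_fderiv_apply_nonpos hd hd2 _

theorem laplacian_sub (hf : ∀ᶠ y in 𝓝 x, DifferentiableAt ℝ f y)
    (hf2 : DifferentiableAt ℝ (fderiv ℝ f) x) (hg : ∀ᶠ y in 𝓝 x, DifferentiableAt ℝ g y)
    (hg2 : DifferentiableAt ℝ (fderiv ℝ g) x) :
    laplacian (fun y => f y - g y) x = laplacian f x - laplacian g x := by
  rw [laplacian, laplacian, laplacian, ← Finset.sum_sub_distrib]
  refine Finset.sum_congr rfl fun i _ => ?_
  set v : EuclideanSpace ℝ (Fin n) := EuclideanSpace.single i 1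
  have h : (fun y => fderiv ℝ (fun y => f y - g y) y v) =ᶠ[𝓝 x]
      fun y => fderiv ℝ f y v - fderiv ℝ g y v := by
    filter_upwards [hf, hg] with y h1 h2
    rw [fderiv_fun_sub h1 h2, sub_apply]
  rw [h.fderiv_eq, fderiv_fun_sub (hf2.clm_apply (differentiableAt_const v))
    (hg2.clm_apply (differentiableAt_const v)), sub_apply]

theorem laplacian_const_mul_sub_norm_sq (a L : ℝ) (x : EuclideanSpace ℝ (Fin n)) :
    laplacian (fun y => a * (L - ‖y‖ ^ 2)) x = -(2 * n * a) := by
  have h (i : Fin n) : (fun y : EuclideanSpace ℝ (Fin n) =>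
      fderiv ℝ (fun y => a * (L - ‖y‖ ^ 2)) y (EuclideanSpace.single i 1)) =
      fun y => (-(2 * a)) * EuclideanSpace.proj (𝕜 := ℝ) i y := by
    ext y
    have h1 := (((hasStrictFDerivAt_norm_sq y).hasFDerivAt).const_sub L).const_mul a
    rw [h1.fderiv]
    simp [EuclideanSpace.inner_single_right]
    ring
  have h2 (i : Fin n) : fderiv ℝ (fun y : EuclideanSpace ℝ (Fin n) =>
      (-(2 * a)) * EuclideanSpace.proj (𝕜 := ℝ) i y) x (EuclideanSpace.single i 1) = -(2 * a) := by
    rw [((EuclideanSpace.proj (𝕜 := ℝ) i).hasFDerivAt.const_mul (-(2 * a))).fderiv]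
    simp
  simp only [laplacian, h, h2]
  simp
  ring

end Laplacian

/-- Comparison of a solution of the heat equation with the supersolution
`M (L - ‖x‖²) exp (-μ t)`. -/
theorem heat_dirichlet_le_exp_decay
    {n : ℕ} (hn : 1 ≤ n) {Ω : Set (EuclideanSpace ℝ (Fin n))}
    (hΩo : IsOpen Ω) (hΩb : Bornology.IsBounded Ω)
    {κ : ℝ} (hκ : 0 < κ) {u : ℝ → EuclideanSpace ℝ (Fin n) → ℝ}
    (hcont : ContinuousOn (fun p : ℝ × EuclideanSpace ℝ (Fin n) => u p.1 p.2)
      (Set.Ici (0 : ℝ) ×ˢ closure Ω))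
    (hreg : ∀ t : ℝ, 0 < t → ∀ x ∈ Ω,
      DifferentiableAt ℝ (fun s => u s x) t ∧
      DifferentiableAt ℝ (u t) x ∧
      DifferentiableAt ℝ (fderiv ℝ (u t)) x)
    (hheat : ∀ t : ℝ, 0 < t → ∀ x ∈ Ω,
      deriv (fun s => u s x) t = κ * laplacian (u t) x)
    (hbdry : ∀ t : ℝ, 0 ≤ t → ∀ x ∈ frontier Ω, u t x = 0) :
    ∃ C μ : ℝ, 0 < μ ∧ ∀ t : ℝ, 0 ≤ t → ∀ x ∈ closure Ω, u t x ≤ C * exp (-(μ * t)) := by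
  have hcomp : IsCompact (closure Ω) := hΩb.isCompact_closure
  obtain ⟨R, hR⟩ := hcomp.isBounded.exists_norm_le
  set L : ℝ := R ^ 2 + 1 with hL
  have hLpos : 0 < L := by positivity
  have hg1 : ∀ x ∈ closure Ω, 1 ≤ L - ‖x‖ ^ 2 := fun x hx => by
    have := pow_le_pow_left₀ (norm_nonneg x) (hR x hx) 2
    linarith
  have hgL : ∀ x : EuclideanSpace ℝ (Fin n), L - ‖x‖ ^ 2 ≤ L := fun x => by
    linarith [sq_nonneg ‖x‖]
  obtain ⟨B, hB⟩ : ∃ B, ∀ x ∈ closure Ω, u 0 x ≤ B := by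
    have hc : ContinuousOn (u 0) (closure Ω) :=
      hcont.comp (f := fun x => ((0 : ℝ), x)) (by fun_prop) fun x hx => ⟨Set.self_mem_Ici, hx⟩
    obtain ⟨B, hB⟩ := hcomp.bddAbove_image hc
    exact ⟨B, fun x hx => hB ⟨x, hx, rfl⟩⟩
  set M : ℝ := |B| + 1 with hM
  have hMpos : 0 < M := by positivity
  have hBM : B < M := by linarith [le_abs_self B]
  set μ : ℝ := κ / L with hμ
  have hμpos : 0 < μ := by positivity
  set v : ℝ → EuclideanSpace ℝ (Fin n) → ℝ :=
    fun t x => (M * exp (-(μ * t))) * (L - ‖x‖ ^ 2) with hv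
  have hvpos : ∀ t, ∀ x ∈ closure Ω, 0 < v t x := fun t x hx =>
    mul_pos (by positivity) (by linarith [hg1 x hx])
  suffices hle : ∀ t : ℝ, 0 ≤ t → ∀ x ∈ closure Ω, u t x ≤ v t x by
    refine ⟨M * L, μ, hμpos, fun t ht x hx => (hle t ht x hx).trans ?_⟩
    calc v t x ≤ (M * exp (-(μ * t))) * L := mul_le_mul_of_nonneg_left (hgL x) (by positivity)
      _ = M * L * exp (-(μ * t)) := by ring
  intro T hT y hy
  by_contra! hlt
  have hvcont : Continuous fun p : ℝ × EuclideanSpace ℝ (Fin n) => v p.1 p.2 := by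
    simp only [hv]
    fun_prop
  obtain ⟨⟨t₀, x₀⟩, ⟨⟨ht0, htT⟩, hx₀⟩, hmax⟩ :=
    (isCompact_Icc (a := (0 : ℝ)) (b := T)).prod hcomp |>.exists_isMaxOn
      ⟨(T, y), ⟨hT, le_rfl⟩, hy⟩
      ((hcont.mono (Set.prod_mono_left Set.Icc_subset_Ici_self)).sub hvcont.continuousOn)
  have hmax' : ∀ s ∈ Set.Icc 0 T, ∀ x ∈ closure Ω, u s x - v s x ≤ u t₀ x₀ - v t₀ x₀ :=
    fun s hs x hx => hmax (show (s, x) ∈ Set.Icc 0 T ×ˢ closure Ω from ⟨hs, hx⟩)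
  simp only at ht0 htT hx₀
  have hwpos : 0 < u t₀ x₀ - v t₀ x₀ := by
    linarith [hmax' T ⟨hT, le_rfl⟩ y hy]
  have ht₀ : 0 < t₀ := by
    refine lt_of_le_of_ne ht0 fun h => ?_
    subst h
    have h1 : M ≤ v 0 x₀ := by
      simpa [hv] using le_mul_of_one_le_right hMpos.le (hg1 x₀ hx₀)
    linarith [hB x₀ hx₀]
  have hxΩ : x₀ ∈ Ω := by
    by_contra hx
    have := hbdry t₀ ht0 x₀ (by rw [hΩo.frontier_eq]; exact ⟨hx₀, hx⟩)
    linarith [hvpos t₀ x₀ hx₀]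
  have hΩnhds : Ω ∈ 𝓝 x₀ := hΩo.mem_nhds hxΩ
  obtain ⟨hut, -, hu2⟩ := hreg t₀ ht₀ x₀ hxΩ
  have hu1 : ∀ᶠ x in 𝓝 x₀, DifferentiableAt ℝ (u t₀) x := by
    filter_upwards [hΩnhds] with x hx using (hreg t₀ ht₀ x hx).2.1
  have hvsmooth : ContDiff ℝ 2 (v t₀) :=
    contDiff_const.mul (contDiff_const.sub (contDiff_norm_sq ℝ))
  have hv1 : Differentiable ℝ (v t₀) := hvsmooth.differentiable (by norm_num)
  have hv2 : Differentiable ℝ (fderiv ℝ (v t₀)) :=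
    (hvsmooth.fderiv_right (m := 1) (by norm_num)).differentiable (by norm_num)
  have hspace : laplacian (fun x => u t₀ x - v t₀ x) x₀ ≤ 0 := by
    refine IsLocalMax.laplacian_nonpos ?_ ?_ ?_
    · filter_upwards [hΩnhds] with x hx using hmax' t₀ ⟨ht0, htT⟩ x (subset_closure hx)
    · filter_upwards [hu1] with x hx using hx.sub (hv1 x)
    · have h : fderiv ℝ (fun x => u t₀ x - v t₀ x) =ᶠ[𝓝 x₀]
          fun x => fderiv ℝ (u t₀) x - fderiv ℝ (v t₀) x := by
        filter_upwards [hu1] with x hx using fderiv_fun_sub hx (hv1 x)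
      exact (hu2.sub (hv2 x₀)).congr_of_eventuallyEq h
  rw [laplacian_sub hu1 hu2 (Eventually.of_forall hv1) (hv2 x₀),
    laplacian_const_mul_sub_norm_sq] at hspace
  have hvt : HasDerivAt (fun s => v s x₀)
      ((M * (exp (-(μ * t₀)) * -μ)) * (L - ‖x₀‖ ^ 2)) t₀ := by
    have h : HasDerivAt (fun s : ℝ => -(μ * s)) (-μ) t₀ := by
      simpa using ((hasDerivAt_id t₀).const_mul μ).fun_neg
    exact (h.exp.const_mul M).mul_const _
  have htime := (hut.hasDerivAt.sub hvt).nonneg_of_isMaxOn_Icc ht₀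
    fun s hs => hmax' s ⟨hs.1, hs.2.trans htT⟩ x₀ hx₀
  rw [hheat t₀ ht₀ x₀ hxΩ] at htime
  set a : ℝ := M * exp (-(μ * t₀)) with ha
  have hapos : 0 < a := by positivity
  have hμg : μ * (L - ‖x₀‖ ^ 2) ≤ κ := by
    calc μ * (L - ‖x₀‖ ^ 2) ≤ μ * L := mul_le_mul_of_nonneg_left (hgL x₀) hμpos.le
      _ = κ := div_mul_cancel₀ κ hLpos.ne'
  have hn' : (1 : ℝ) ≤ n := by exact_mod_cast hn
  have h1 : κ * laplacian (u t₀) x₀ ≤ κ * (-(2 * a)) :=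
    mul_le_mul_of_nonneg_left (by nlinarith) hκ.le
  have h2 : a * (μ * (L - ‖x₀‖ ^ 2)) ≤ a * κ := mul_le_mul_of_nonneg_left hμg hapos.le
  have h3 : M * (exp (-(μ * t₀)) * -μ) * (L - ‖x₀‖ ^ 2) = -(a * (μ * (L - ‖x₀‖ ^ 2))) := by
    rw [ha]; ring
  nlinarith [mul_pos hapos hκ]

/-- Lemma C.1: a classical solution of the Dirichlet problem for the heat
equation `∂ₜu = κ̄Δu` on a bounded domain `Ω`, continuous on `[0,∞) × cl(Ω)`
and vanishing on the boundary, tends to zero uniformly on `cl(Ω)` as `t → ∞`. -/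
theorem heat_dirichlet_uniform_decay
    {n : ℕ} (hn : 1 ≤ n) (Ω : Set (EuclideanSpace ℝ (Fin n)))
    (hΩo : IsOpen Ω) (hΩne : Ω.Nonempty) (hΩb : Bornology.IsBounded Ω)
    (κ : ℝ) (hκ : 0 < κ) (u : ℝ → EuclideanSpace ℝ (Fin n) → ℝ)
    (hcont : ContinuousOn (fun p : ℝ × EuclideanSpace ℝ (Fin n) => u p.1 p.2)
      (Set.Ici (0 : ℝ) ×ˢ closure Ω))
    (hreg : ∀ t : ℝ, 0 < t → ∀ x ∈ Ω,
      DifferentiableAt ℝ (fun s => u s x) t ∧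
      DifferentiableAt ℝ (u t) x ∧
      DifferentiableAt ℝ (fderiv ℝ (u t)) x)
    (hheat : ∀ t : ℝ, 0 < t → ∀ x ∈ Ω,
      deriv (fun s => u s x) t = κ * laplacian (u t) x)
    (hbdry : ∀ t : ℝ, 0 ≤ t → ∀ x ∈ frontier Ω, u t x = 0) :
    Tendsto (fun t : ℝ => sSup ((fun x => |u t x|) '' closure Ω))
      atTop (𝓝 0) := by
  obtain ⟨C, μ, hμ, hC⟩ := heat_dirichlet_le_exp_decay hn hΩo hΩb hκ hcont hreg hheat hbdry
  obtain ⟨C', μ', hμ', hC'⟩ := heat_dirichlet_le_exp_decay (u := fun t x => -u t x) hn hΩo hΩb hκ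
    hcont.neg
    (fun t ht x hx => by
      obtain ⟨h1, h2, h3⟩ := hreg t ht x hx
      refine ⟨h1.fun_neg, h2.fun_neg, ?_⟩
      have h : fderiv ℝ (fun y => -u t y) = fun y => -fderiv ℝ (u t) y := by
        ext1 y
        exact fderiv_fun_neg
      rw [h]
      exact h3.fun_neg)
    (fun t ht x hx => by
      rw [deriv.fun_neg, laplacian_neg, hheat t ht x hx, mul_neg])
    (fun t ht x hx => by rw [hbdry t ht x hx, neg_zero])
  have hdecay : ∀ (C : ℝ) {μ : ℝ}, 0 < μ →
      Tendsto (fun t : ℝ => C * exp (-(μ * t))) atTop (𝓝 0) := fun C μ hμ => by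
    simpa using (tendsto_exp_neg_atTop_nhds_zero.comp
      (tendsto_id.const_mul_atTop hμ)).const_mul C
  have hlim : Tendsto (fun t : ℝ => max (C * exp (-(μ * t))) (C' * exp (-(μ' * t))))
      atTop (𝓝 0) := by
    simpa using (hdecay C hμ).max (hdecay C' hμ')
  refine squeeze_zero' (Eventually.of_forall fun t => ?_) ?_ hlim
  · exact Real.sSup_nonneg (by rintro _ ⟨x, -, rfl⟩; exact abs_nonneg _)
  · filter_upwards [eventually_ge_atTop 0] with t ht
    refine csSup_le (hΩne.closure.image _) ?_
    rintro _ ⟨x, hx, rfl⟩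
    exact max_le_max (hC t ht x hx) (hC' t ht x hx)
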